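/- Let F = ℚ(x, y) be the rational function field in two variables. Then S^⧢[ I^+_{4,1}(x, y) + I^+_{4,1}(1 − x, y) ] = S^⧢[ (1/12)Li_5(x²y/((1−x)(1−y)²)) + (1/12)Li_5((1−x)²y/(x(1−y)²)) + (1/6)Li_5((1−x)x y²/(y−1)) + (1/6)Li_5((1−y)y/((1−x)x)) − (1/2)Li_5((1−x)/(x(y−1))) − (1/2)Li_5(xy/((1−x)(1−y))) − (1/2)Li_5((1−x)(1−y)/(−x)) − (1/2)Li_5((1−x)y/(x(1−y))) − (7/4)Li_5(y/(1−x)) − (7/4)Li_5((1−x)y) − (7/4)Li_5(y/x) − (7/4)Li_5(xy) − Li_5((1−y)/x) − Li_5((1−x)/(1−y)) − Li_5((1−x)y/(y−1)) − Li_5(xy/(y−1)) + (1/2)Li_5(1−x) + (1/2)Li_5(1/x) + Li_5((x−1)/x) + Li_5(1/(1−y)) + Li_5(y/(y−1)) ] in V_F^{⊗5}. -/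

import Mathlib

open scoped TensorProduct
open PiTensorProduct

attribute [local instance] Classical.propDecidable

set_option maxHeartbeats 1000000
set_option synthInstance.maxHeartbeats 400000

noncomputable section

namespace GrassPoly

variable (F : Type) [Field F]

/-- `V_F = F^× ⊗_ℤ ℚ` as a `ℚ`-vector space. -/
abbrev VF : Type := ℚ ⊗[ℤ] (Additive Fˣ)

variable {F}

/-- The class `[a]` of a nonzero field element in `V_F` (defined to be `0` for `a = 0`). -/
def cls (a : F) : VF F :=
  if h : a = 0 then 0 else (1 : ℚ) ⊗ₜ[ℤ] (Additive.ofMul (Units.mk0 a h))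

variable (F) in
/-- Tensor powers of V_F over ℚ. -/
abbrev TP (n : ℕ) : Type := ⨂[ℚ]^n (VF F)

instance instTPAddCommGroup (n : ℕ) : AddCommGroup (TP F n) :=
  Module.addCommMonoidToAddCommGroup ℚ

/-- Appending one extra tensor factor on the right. -/
def snoc {n : ℕ} : TP F n →ₗ[ℚ] VF F →ₗ[ℚ] TP F (n + 1) :=
  PiTensorProduct.lift
    ((PiTensorProduct.tprod ℚ (s := fun _ : Fin (n + 1) => VF F)).curryRight)

/-- The factor `t_i` appearing in the recursive definition of the symbol,
as a function of `(a_{i-1}, a_i, a_{i+1})`. -/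
def tCoef (p a q : F) : VF F :=
  if p = a then (if a = q then 0 else cls (q - a))
  else if a = q then - cls (p - a)
  else cls ((q - a) / (p - a))

/-- The symbol `S I(a₀; a₁, …, a_m; a_{m+1})`, with the middle entries given as a list
(of length `n`). -/
def SIaux : (n : ℕ) → (a0 : F) → (as : List F) → (b : F) → as.length = n → TP F n
  | 0, _, _, _, _ => tprod ℚ (fun i : Fin 0 => i.elim0)
  | n + 1, a0, as, b, h =>
      ∑ i : Fin (n + 1),
        snoc (SIaux n a0 (as.eraseIdx i.val) b
            (by
              have hi' := i.isLt
              have hi : i.val < as.length := by omega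
              have h2 := List.length_eraseIdx_of_lt hi
              omega))
          (tCoef ((a0 :: as).getD i.val 0) (as.getD i.val 0) ((as ++ [b]).getD (i.val + 1) 0))

/-- Cyclic rotation `b₁ ⊗ … ⊗ b_N ↦ b₂ ⊗ … ⊗ b_N ⊗ b₁` on tensor powers. -/
def rotN (n : ℕ) : TP F n ≃ₗ[ℚ] TP F n :=
  PiTensorProduct.reindex ℚ (fun _ : Fin n => VF F) (finRotate n).symm

/-- Splitting off the last tensor factor. -/
def splitLast (n : ℕ) : TP F (n + 1) ≃ₗ[ℚ] (TP F n) ⊗[ℚ] (VF F) :=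
  ((PiTensorProduct.reindex ℚ (fun _ : Fin (n + 1) => VF F)
      (finSumFinEquiv (m := n) (n := 1)).symm).trans
    (PiTensorProduct.tmulEquiv ℚ (VF F)).symm).trans
    (TensorProduct.congr (LinearEquiv.refl ℚ _)
      (PiTensorProduct.subsingletonEquiv (0 : Fin 1)))

/-- The projector `Π̃_N` annihilating symbols of products. -/
def Pit : (n : ℕ) → TP F n →ₗ[ℚ] TP F n
  | 0 => LinearMap.id
  | 1 => LinearMap.id
  | (n + 2) =>
      ((splitLast (n + 1)).symm.toLinearMap
        ∘ₗ TensorProduct.map (Pit (n + 1)) LinearMap.id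
        ∘ₗ (splitLast (n + 1)).toLinearMap)
      ∘ₗ ((LinearMap.id : TP F (n + 2) →ₗ[ℚ] TP F (n + 2)) - (rotN (F := F) (n + 2)).toLinearMap)

/-- The map on `V_F` induced by a field automorphism. -/
def vmap (φ : F ≃+* F) : VF F →ₗ[ℚ] VF F :=
  TensorProduct.AlgebraTensorModule.map (LinearMap.id : ℚ →ₗ[ℚ] ℚ)
    (AddMonoidHom.toIntLinearMap
      { toFun := fun a => Additive.ofMul ((Units.map (φ : F →* F)) a.toMul)
        map_zero' := by simp
        map_add' := by intro a b; simp [_root_.map_mul] })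

/-- The induced map on tensor powers. -/
def tpMap {n : ℕ} (φ : F ≃+* F) : TP F n →ₗ[ℚ] TP F n :=
  PiTensorProduct.map (fun _ => vmap φ)


/-! ### Symbols of (multiple) polylogarithms -/

/-- Symbol of `Li₂`. -/
def SLi2 (x : F) : TP F 2 := - SIaux 2 0 [x⁻¹, 0] 1 rfl

/-- Symbol of `Li₃`. -/
def SLi3 (x : F) : TP F 3 := - SIaux 3 0 [x⁻¹, 0, 0] 1 rfl

/-- Symbol of `Li₄`. -/
def SLi4 (x : F) : TP F 4 := - SIaux 4 0 [x⁻¹, 0, 0, 0] 1 rfl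

/-- Symbol of `Li₅`. -/
def SLi5 (x : F) : TP F 5 := - SIaux 5 0 [x⁻¹, 0, 0, 0, 0] 1 rfl

/-- Symbol of `I_{3,1}(x,y) = I(0; x,0,0,y; 1)`. -/
def SI31 (x y : F) : TP F 4 := SIaux 4 0 [x, 0, 0, y] 1 rfl

/-- Symbol of `I_{4,1}(x,y) = I(0; x,0,0,0,y; 1)`. -/
def SI41 (x y : F) : TP F 5 := SIaux 5 0 [x, 0, 0, 0, y] 1 rfl

/-- Symbol of `I⁺_{4,1}(x,y) = ½ (I_{4,1}(x,y) + I_{4,1}(x,y⁻¹))`. -/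
def I41p (x y : F) : TP F 5 := (2 : ℚ)⁻¹ • (SI41 x y + SI41 x y⁻¹)

/-- The anharmonic orbit of `x`, together with the signs of the
corresponding permutations in `S₃`. -/
def anhList (x : F) : List (ℚ × F) :=
  [(1, x), (1, (1 - x)⁻¹), (1, 1 - x⁻¹), (-1, x⁻¹), (-1, 1 - x), (-1, x / (x - 1))]

/-- Symbol of `Ĩ_{3,1}(x,y) = (1/36) Σ_{σ,π ∈ S₃} sgn(σ) sgn(π) I_{3,1}(x^σ, y^π)`. -/
def tI31 (x y : F) : TP F 4 :=
  (36 : ℚ)⁻¹ •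
    ((anhList x).map (fun p =>
      ((anhList y).map (fun q => (p.1 * q.1) • SI31 p.2 q.2)).sum)).sum

/-- Symbol of `Ĩ⁺_{4,1}(x,y) = (1/6) Σ_{σ ∈ S₃} sgn(σ) I⁺_{4,1}(x^σ, y)`. -/
def tI41p (x y : F) : TP F 5 :=
  (6 : ℚ)⁻¹ • ((anhList x).map (fun p => p.1 • I41p p.2 y)).sum

/-- Symbol of `V(z; x, y) = Ĩ_{3,1}(z, [x]+[y]+[(1-x)/(1-xy)]+[1-xy]+[(1-y)/(1-xy)])`. -/
def Vc (z x y : F) : TP F 4 :=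
  tI31 z x + tI31 z y + tI31 z ((1 - x) / (1 - x * y)) + tI31 z (1 - x * y)
    + tI31 z ((1 - y) / (1 - x * y))

/-- `Sym₃₆(a,b) := I_{3,1}(a,b) - Ĩ_{3,1}(a,b)` (on the level of symbols). -/
def S36 (a b : F) : TP F 4 := SI31 a b - tI31 a b

/-! ### Generic vectors -/

variable (N m : ℕ)

/-- Polynomial ring on the entries of `N` generic vectors in `m`-space. -/
abbrev Pol : Type := MvPolynomial (Fin N × Fin m) ℚ

/-- The field of rational functions in the entries of `N` generic vectors in `m`-space. -/
abbrev FF : Type := FractionRing (Pol N m)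

/-- The `j`-th coordinate of the `i`-th generic vector. -/
def gen (i : Fin N) (j : Fin m) : FF N m :=
  algebraMap (Pol N m) (FF N m) (MvPolynomial.X (i, j))

/-- `⟨i₁ … i_m⟩`: the determinant of the matrix whose columns are
the generic vectors selected by `cols`. -/
def dets (cols : Fin m → Fin N) : FF N m :=
  (Matrix.of fun r c => gen N m (cols c) r).det

/-- The field automorphism of `FF N m` induced by a permutation of the `N` vectors. -/
def permAut (σ : Equiv.Perm (Fin N)) : FF N m ≃+* FF N m :=
  IsFractionRing.ringEquivOfRingEquiv
    ((MvPolynomial.renameEquiv ℚ (σ.prodCongr (Equiv.refl (Fin m)))).toRingEquiv)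

variable {N m}

/-- Skew-symmetrization over all permutations of the `N` generic vectors. -/
def Alt {n : ℕ} (x : TP (FF N m) n) : TP (FF N m) n :=
  ∑ σ : Equiv.Perm (Fin N), (((Equiv.Perm.sign σ : ℤˣ) : ℤ) : ℚ) • tpMap (permAut N m σ) x

end GrassPoly

end

namespace GrassPoly

noncomputable section TwoVar

/-- The rational function field `ℚ(x, y)`. -/
abbrev K2 : Type := FractionRing (MvPolynomial (Fin 2) ℚ)

/-- The variable `x`. -/
def xx : K2 := algebraMap (MvPolynomial (Fin 2) ℚ) K2 (MvPolynomial.X 0)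

/-- The variable `y`. -/
def yy : K2 := algebraMap (MvPolynomial (Fin 2) ℚ) K2 (MvPolynomial.X 1)

end TwoVar

end GrassPoly

open GrassPoly

namespace GrassPoly

section WordCalculus

variable {F : Type} [Field F]

/-- The vector with integral coordinates `w` with respect to the first `m` members of `e`. -/
noncomputable def vecOf (m : ℕ) (e : ℕ → VF F) (w : List ℤ) : VF F :=
  ∑ l ∈ Finset.range m, (w.getD l 0 : ℚ) • e l

/-- The elementary tensor of the first `n` vectors of `w`, read from right to left. -/
noncomputable def wordTensor (m : ℕ) (e : ℕ → VF F) : (n : ℕ) → List (List ℤ) → TP F n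
  | 0, _ => tprod ℚ (fun i : Fin 0 => i.elim0)
  | n + 1, w => snoc (wordTensor m e n w.tail) (vecOf m e (w.headD []))

/-- The tensor represented by a list of words with integral coefficients. -/
noncomputable def wordSum (m : ℕ) (e : ℕ → VF F) (n : ℕ) (ts : List (ℤ × List (List ℤ))) :
    TP F n :=
  (ts.map fun t => (t.1 : ℚ) • wordTensor m e n t.2).sum

/-- The expansion of `Pit n` on a word. -/
def pitWords : ℕ → List (List ℤ) → List (ℤ × List (List ℤ))
  | 0, w => [(1, w)]
  | 1, w => [(1, w)]
  | n + 2, w =>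
      if n = 0 ∧ w.headD [] = w.getD (n + 1) [] then []
      else (pitWords (n + 1) w.tail).map (fun t => (t.1, w.headD [] :: t.2)) ++
        (pitWords (n + 1) w).map (fun t => (-t.1, w.getD (n + 1) [] :: t.2))

/-- The expansion of `Pit n` on a list of words with coefficients. -/
def pitSum (n : ℕ) (ts : List (ℤ × List (List ℤ))) : List (ℤ × List (List ℤ)) :=
  ts.flatMap fun t => (pitWords n t.2).map fun u => (t.1 * u.1, u.2)

/-- Extraction of the coefficient of the `l`-th basis vector in the head position. -/
def headCoeff (l : ℕ) (t : ℤ × List (List ℤ)) : Option (ℤ × List (List ℤ)) :=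
  match (t.2.headD []).getD l 0 with
  | .ofNat 0 => none
  | k => some (t.1 * k, t.2.tail)

/-- Test whether all coefficients of a list of words of length `n` in `m` letters cancel. -/
def wordsCancel (m : ℕ) : ℕ → List (ℤ × List (List ℤ)) → Bool
  | 0, ts => (ts.map Prod.fst).sum == 0
  | n + 1, ts => ts.isEmpty ||
      (List.range m).all fun l => wordsCancel m n (ts.filterMap (headCoeff l))

theorem snoc_tprod {n : ℕ} (v : Fin n → VF F) (a : VF F) :
    snoc (tprod ℚ v) a = tprod ℚ (Fin.snoc v a : Fin (n + 1) → VF F) := by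
  simp [snoc]

theorem splitLast_snoc {n : ℕ} (T : TP F n) (a : VF F) :
    splitLast n (snoc T a) = T ⊗ₜ[ℚ] a := by
  induction T using PiTensorProduct.induction_on with
  | smul_tprod r v =>
    rw [map_smul, LinearMap.smul_apply, map_smul, snoc_tprod, ← TensorProduct.smul_tmul']
    congr 1
    simp only [splitLast, LinearEquiv.trans_apply, PiTensorProduct.reindex_tprod]
    rw [PiTensorProduct.tmulEquiv_symm_apply]
    simp only [TensorProduct.congr_tmul, LinearEquiv.refl_apply,
      PiTensorProduct.subsingletonEquiv_apply_tprod, Equiv.symm_symm]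
    congr 1
    · congr 1
      funext i
      have : (Fin.castAdd 1 i) = i.castSucc := rfl
      simp [this]
    · have : (Fin.natAdd n (0 : Fin 1)) = Fin.last n := rfl
      simp [this]
  | add S T hS hT =>
    rw [map_add, LinearMap.add_apply, map_add, hS, hT, TensorProduct.add_tmul]

theorem Pit_succ_succ (n : ℕ) (T : TP F (n + 1)) (a : VF F) (S : TP F (n + 1)) (b : VF F)
    (h : rotN (n + 2) (snoc T a) = snoc S b) :
    Pit (n + 2) (snoc T a) = snoc (Pit (n + 1) T) a - snoc (Pit (n + 1) S) b := by
  have key : ∀ (R : TP F (n + 1)) (c : VF F),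
      (splitLast (n + 1)).symm (TensorProduct.map (Pit (n + 1)) LinearMap.id
        (splitLast (n + 1) (snoc R c))) = snoc (Pit (n + 1) R) c := by
    intro R c
    rw [LinearEquiv.symm_apply_eq, splitLast_snoc, splitLast_snoc, TensorProduct.map_tmul,
      LinearMap.id_apply]
  simp only [Pit, LinearMap.comp_apply, LinearMap.sub_apply, LinearMap.id_apply,
    LinearEquiv.coe_coe, map_sub]
  rw [key, h, key]

theorem wordTensor_eq_tprod (m : ℕ) (e : ℕ → VF F) (n : ℕ) (w : List (List ℤ)) :
    wordTensor m e n w = tprod ℚ fun i : Fin n => vecOf m e (w.getD (n - 1 - i) []) := by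
  induction n generalizing w with
  | zero =>
    rw [wordTensor]
    congr 1
    funext i
    exact i.elim0
  | succ n ih =>
    rw [wordTensor, ih, snoc_tprod]
    congr 1
    funext i
    refine Fin.lastCases ?_ (fun j => ?_) i
    · cases w <;> simp
    · have hj := j.isLt
      have : n + 1 - 1 - (j.castSucc : ℕ) = (n - 1 - j) + 1 := by
        simp only [Fin.val_castSucc]; omega
      rw [Fin.snoc_castSucc, this]
      cases w <;> simp

theorem rotN_wordTensor (m : ℕ) (e : ℕ → VF F) (n : ℕ) (w : List (List ℤ)) :
    rotN (n + 1) (wordTensor m e (n + 1) w) =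
      snoc (wordTensor m e n w) (vecOf m e (w.getD n [])) := by
  rw [wordTensor_eq_tprod, wordTensor_eq_tprod, snoc_tprod, rotN, PiTensorProduct.reindex_tprod]
  congr 1
  funext i
  refine Fin.lastCases ?_ (fun j => ?_) i
  · simp
  · have hj := j.isLt
    have h2 : ((finRotate (n + 1) j.castSucc : Fin (n + 1)) : ℕ) = j + 1 := by
      simp
    rw [Fin.snoc_castSucc, Equiv.symm_symm, h2]
    congr 2
    omega

theorem wordSum_nil (m : ℕ) (e : ℕ → VF F) (n : ℕ) : wordSum m e n [] = 0 := by
  simp [wordSum]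

theorem wordSum_cons (m : ℕ) (e : ℕ → VF F) (n : ℕ) (t : ℤ × List (List ℤ))
    (ts : List (ℤ × List (List ℤ))) :
    wordSum m e n (t :: ts) = (t.1 : ℚ) • wordTensor m e n t.2 + wordSum m e n ts := by
  simp [wordSum]

theorem wordSum_append (m : ℕ) (e : ℕ → VF F) (n : ℕ) (ts us : List (ℤ × List (List ℤ))) :
    wordSum m e n (ts ++ us) = wordSum m e n ts + wordSum m e n us := by
  simp [wordSum]

theorem wordSum_map_cons (m : ℕ) (e : ℕ → VF F) (n : ℕ) (c : ℤ) (a : List ℤ)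
    (ts : List (ℤ × List (List ℤ))) :
    wordSum m e (n + 1) (ts.map fun t => (c * t.1, a :: t.2)) =
      (c : ℚ) • snoc (wordSum m e n ts) (vecOf m e a) := by
  induction ts with
  | nil => simp [wordSum_nil]
  | cons t ts ih =>
    rw [List.map_cons, wordSum_cons, wordSum_cons, ih]
    simp [wordTensor, mul_smul]

theorem wordSum_map_mul (m : ℕ) (e : ℕ → VF F) (n : ℕ) (c : ℤ)
    (ts : List (ℤ × List (List ℤ))) :
    wordSum m e n (ts.map fun t => (c * t.1, t.2)) = (c : ℚ) • wordSum m e n ts := by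
  induction ts with
  | nil => simp [wordSum_nil]
  | cons t ts ih =>
    rw [List.map_cons, wordSum_cons, wordSum_cons, ih]
    simp [mul_smul]

theorem Pit_wordTensor (m : ℕ) (e : ℕ → VF F) (n : ℕ) (w : List (List ℤ)) :
    Pit n (wordTensor m e n w) = wordSum m e n (pitWords n w) := by
  induction n generalizing w with
  | zero => simp [Pit, pitWords, wordSum]
  | succ n ih =>
    cases n with
    | zero => simp [Pit, pitWords, wordSum]
    | succ n =>
      have h1 := wordSum_map_cons m e (n + 1) 1 (w.headD []) (pitWords (n + 1) w.tail)
      have h2 := wordSum_map_cons m e (n + 1) (-1) (w.getD (n + 1) []) (pitWords (n + 1) w)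
      simp only [one_mul, neg_mul] at h1 h2
      rw [wordTensor, Pit_succ_succ n _ _ _ _ (rotN_wordTensor m e (n + 1) w), ih, ih, pitWords]
      split_ifs with h
      · obtain ⟨rfl, h⟩ := h
        simp only [pitWords, wordSum_cons, wordSum_nil, wordTensor, h]
        rcases w with _ | ⟨a, _ | ⟨b, w⟩⟩ <;> simp
      · rw [wordSum_append, h1, h2]
        simp [sub_eq_add_neg]

theorem Pit_wordSum (m : ℕ) (e : ℕ → VF F) (n : ℕ) (ts : List (ℤ × List (List ℤ))) :
    Pit n (wordSum m e n ts) = wordSum m e n (pitSum n ts) := by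
  induction ts with
  | nil => simp [wordSum, pitSum]
  | cons t ts ih =>
    rw [wordSum_cons, map_add, map_smul, ih, Pit_wordTensor, pitSum, pitSum,
      List.flatMap_cons, wordSum_append, wordSum_map_mul]

theorem wordSum_succ (m : ℕ) (e : ℕ → VF F) (n : ℕ) (ts : List (ℤ × List (List ℤ))) :
    wordSum m e (n + 1) ts =
      ∑ l ∈ Finset.range m, snoc (wordSum m e n (ts.filterMap (headCoeff l))) (e l) := by
  induction ts with
  | nil => simp [wordSum_nil]
  | cons t ts ih =>
    rw [wordSum_cons, ih, wordTensor, vecOf, map_sum, Finset.smul_sum, ← Finset.sum_add_distrib]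
    refine Finset.sum_congr rfl fun l _ => ?_
    rw [List.filterMap_cons, headCoeff, map_smul]
    split
    · rename_i h
      split at h
      · rename_i h0
        rw [show (t.2.headD []).getD l 0 = 0 from h0, Int.cast_zero, zero_smul, smul_zero,
          zero_add]
      · simp at h
    · rename_i h
      split at h
      · simp at h
      · obtain rfl := Option.some.inj h
        rw [wordSum_cons, map_add, LinearMap.add_apply, map_smul, LinearMap.smul_apply, smul_smul,
          Int.cast_mul]

theorem wordSum_eq_zero (m : ℕ) (e : ℕ → VF F) (n : ℕ) (ts : List (ℤ × List (List ℤ)))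
    (h : wordsCancel m n ts = true) : wordSum m e n ts = 0 := by
  induction n generalizing ts with
  | zero =>
    have h1 : ∀ us : List (ℤ × List (List ℤ)),
        wordSum m e 0 us = ((us.map Prod.fst).sum : ℚ) • wordTensor m e 0 [] := by
      intro us
      induction us with
      | nil => simp [wordSum_nil]
      | cons u us ih => rw [wordSum_cons, ih]; simp [add_smul, wordTensor]
    rw [wordsCancel, beq_iff_eq] at h
    rw [h1, h, Int.cast_zero, zero_smul]
  | succ n ih =>
    rw [wordsCancel, Bool.or_eq_true, List.isEmpty_iff, List.all_eq_true] at h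
    rcases h with rfl | h
    · exact wordSum_nil m e _
    · rw [wordSum_succ]
      refine Finset.sum_eq_zero fun l hl => ?_
      rw [ih _ (h l (List.mem_range.2 (Finset.mem_range.1 hl))), map_zero, LinearMap.zero_apply]

end WordCalculus

section Classes

variable {F : Type} [Field F]

theorem cls_one : cls (1 : F) = 0 := by
  rw [cls, dif_neg one_ne_zero]
  have : Units.mk0 (1 : F) one_ne_zero = 1 := by ext; rfl
  rw [this, ofMul_one, TensorProduct.tmul_zero]

theorem cls_mul {a b : F} (ha : a ≠ 0) (hb : b ≠ 0) : cls (a * b) = cls a + cls b := by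
  rw [cls, cls, cls, dif_neg ha, dif_neg hb, dif_neg (mul_ne_zero ha hb), ← TensorProduct.tmul_add,
    ← ofMul_mul]
  congr 2
  ext
  rfl

theorem cls_inv {a : F} : cls a⁻¹ = -cls a := by
  by_cases ha : a = 0
  · simp [cls, ha]
  · have h := cls_mul ha (inv_ne_zero ha)
    rw [mul_inv_cancel₀ ha, cls_one] at h
    exact (neg_eq_of_add_eq_zero_right h.symm).symm

theorem cls_div {a b : F} (ha : a ≠ 0) (hb : b ≠ 0) : cls (a / b) = cls a - cls b := by
  rw [div_eq_mul_inv, cls_mul ha (inv_ne_zero hb), cls_inv, sub_eq_add_neg]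

theorem cls_pow {a : F} (ha : a ≠ 0) (n : ℕ) : cls (a ^ n) = (n : ℚ) • cls a := by
  induction n with
  | zero => simp [cls_one]
  | succ n ih => rw [pow_succ, cls_mul (pow_ne_zero n ha) ha, ih]; push_cast; module

theorem cls_zpow {a : F} (ha : a ≠ 0) (n : ℤ) : cls (a ^ n) = (n : ℚ) • cls a := by
  cases n with
  | ofNat n => simpa using cls_pow ha n
  | negSucc n => rw [zpow_negSucc, cls_inv, cls_pow ha]; push_cast; module

theorem cls_eq_of_sq_eq {a b : F} (ha : a ≠ 0) (hb : b ≠ 0) (h : a ^ 2 = b ^ 2) :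
    cls a = cls b := by
  have h1 := congrArg cls h
  rw [cls_pow ha, cls_pow hb] at h1
  exact smul_right_injective _ (by norm_num : ((2 : ℕ) : ℚ) ≠ 0) h1

theorem cls_neg (a : F) : cls (-a) = cls a := by
  by_cases ha : a = 0
  · simp [ha]
  · exact cls_eq_of_sq_eq (neg_ne_zero.2 ha) ha (by ring)

theorem cls_prod_zpow (m : ℕ) (g : ℕ → F) (hg : ∀ l < m, g l ≠ 0) (w : List ℤ) :
    cls (∏ l ∈ Finset.range m, g l ^ w.getD l 0) = vecOf m (fun l => cls (g l)) w := by
  induction m with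
  | zero => simp [vecOf, cls_one]
  | succ m ih =>
    have h : ∏ l ∈ Finset.range m, g l ^ w.getD l 0 ≠ 0 :=
      Finset.prod_ne_zero_iff.2 fun l hl => zpow_ne_zero _ (hg l (by grind))
    rw [Finset.prod_range_succ, cls_mul h (zpow_ne_zero _ (hg m (by omega))),
      ih fun l hl => hg l (by omega), cls_zpow (hg m (by omega)), vecOf, vecOf,
      Finset.sum_range_succ]

end Classes

section Symbols

variable {F : Type} [Field F]

theorem SIaux_single (a : F) (h : [a].length = 1) :
    SIaux 1 0 [a] 1 h = snoc (tprod ℚ (fun i : Fin 0 => i.elim0)) (tCoef 0 a (1 : F)) := by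
  simp [SIaux]

theorem tCoef_zero_mid_zero {x : F} (hx : x ≠ 0) : tCoef 0 x 0 = (0 : VF F) := by
  rw [tCoef, if_neg hx.symm, if_neg hx, div_self (by simpa using hx), cls_one]

theorem tCoef_zero_zero_one : tCoef 0 0 (1 : F) = 0 := by
  rw [tCoef, if_pos rfl, if_neg zero_ne_one, sub_zero, cls_one]

theorem tCoef_zero_zero_zero : tCoef 0 0 (0 : F) = 0 := by
  simp [tCoef]

theorem tCoef_zero_mid_one {x : F} (hx : x ≠ 0) (hx1 : 1 - x ≠ 0) :
    tCoef 0 x 1 = cls (1 - x) - cls x := by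
  have hx2 : x ≠ 1 := fun h => hx1 (by rw [h, sub_self])
  rw [tCoef, if_neg hx.symm, if_neg hx2, zero_sub, cls_div hx1 (neg_ne_zero.2 hx), cls_neg]

theorem tCoef_zero_one {x : F} (hx : x ≠ 0) : tCoef x 0 1 = -cls x := by
  rw [tCoef, if_neg hx, if_neg zero_ne_one, sub_zero, sub_zero, one_div, cls_inv]

theorem tCoef_zero_zero {x : F} (hx : x ≠ 0) : tCoef x 0 0 = -cls x := by
  rw [tCoef, if_neg hx, if_pos rfl, sub_zero]

theorem SIaux_two {x : F} (hx : x ≠ 0) (hx1 : 1 - x ≠ 0) (h : [x, 0].length = 2) :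
    SIaux 2 0 [x, 0] 1 h = snoc (snoc (tprod ℚ (fun i : Fin 0 => i.elim0))
      (cls (1 - x) - cls x)) (-cls x) := by
  rw [SIaux]
  simp [Fin.sum_univ_succ, SIaux_single, tCoef_zero_mid_one hx hx1, tCoef_zero_one hx,
    tCoef_zero_mid_zero hx, tCoef_zero_zero_one]

theorem SIaux_three {x : F} (hx : x ≠ 0) (h : [x, 0, 0].length = 3) :
    SIaux 3 0 [x, 0, 0] 1 h = snoc (SIaux 2 0 [x, 0] 1 rfl) (-cls x) := by
  rw [SIaux]
  simp [Fin.sum_univ_succ, tCoef_zero_zero hx, tCoef_zero_mid_zero hx, tCoef_zero_zero_one]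

theorem SIaux_four {x : F} (hx : x ≠ 0) (h : [x, 0, 0, 0].length = 4) :
    SIaux 4 0 [x, 0, 0, 0] 1 h = snoc (SIaux 3 0 [x, 0, 0] 1 rfl) (-cls x) := by
  rw [SIaux]
  simp [Fin.sum_univ_succ, tCoef_zero_zero hx, tCoef_zero_mid_zero hx, tCoef_zero_zero_one,
    tCoef_zero_zero_zero]

theorem SIaux_five {x : F} (hx : x ≠ 0) (h : [x, 0, 0, 0, 0].length = 5) :
    SIaux 5 0 [x, 0, 0, 0, 0] 1 h = snoc (SIaux 4 0 [x, 0, 0, 0] 1 rfl) (-cls x) := by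
  rw [SIaux]
  simp [Fin.sum_univ_succ, tCoef_zero_zero hx, tCoef_zero_mid_zero hx, tCoef_zero_zero_one,
    tCoef_zero_zero_zero]

theorem SLi5_eq {z : F} (h0 : z ≠ 0) (h1 : 1 - z ≠ 0) :
    SLi5 z = -snoc (snoc (snoc (snoc (snoc (tprod ℚ (fun i : Fin 0 => i.elim0)) (cls (1 - z)))
      (cls z)) (cls z)) (cls z)) (cls z) := by
  have hz := inv_ne_zero h0
  have e : 1 - z⁻¹ = -((1 - z) / z) := by field_simp; ring
  have hz1 : 1 - z⁻¹ ≠ 0 := by rw [e]; exact neg_ne_zero.2 (div_ne_zero h1 h0)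
  have hc : cls (1 - z⁻¹) = cls (1 - z) - cls z := by rw [e, cls_neg, cls_div h1 h0]
  rw [SLi5, SIaux_five hz, SIaux_four hz, SIaux_three hz, SIaux_two hz hz1, hc, cls_inv, neg_neg,
    sub_neg_eq_add, sub_add_cancel]

theorem SI41_eq {x y : F} (hx : x ≠ 0) (hy : y ≠ 0) (hx1 : 1 - x ≠ 0) (hy1 : 1 - y ≠ 0)
    (hxy : x - y ≠ 0) (u v w p q r : VF F) (hu : u = cls (1 - x) - cls x)
    (hv : v = cls (1 - y) - cls y) (hw : w = -cls x) (hp : p = cls (x - y) - cls x)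
    (hq : q = cls (1 - y) - cls (x - y)) (hr : r = cls y - cls x) :
    SI41 x y =
      snoc (snoc (snoc (snoc (snoc (tprod ℚ (fun i : Fin 0 => i.elim0)) v) p) r) r) r +
      snoc (snoc (snoc (snoc (snoc (tprod ℚ (fun i : Fin 0 => i.elim0)) u) q) r) r) r +
      snoc (snoc (snoc (snoc (snoc (tprod ℚ (fun i : Fin 0 => i.elim0)) u) w) v) r) r +
      snoc (snoc (snoc (snoc (snoc (tprod ℚ (fun i : Fin 0 => i.elim0)) u) w) w) v) r +
      snoc (snoc (snoc (snoc (snoc (tprod ℚ (fun i : Fin 0 => i.elim0)) u) w) w) w) v := by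
  have hy2 : y ≠ 1 := fun h => hy1 (by rw [h, sub_self])
  have hxy2 : x ≠ y := fun h => hxy (by rw [h, sub_self])
  have hyx : cls (y - x) = cls (x - y) := by rw [← cls_neg, neg_sub]
  have hyx0 : y - x ≠ 0 := fun h => hxy (by rw [← neg_sub, h, neg_zero])
  have tv : tCoef 0 y 1 = v := by rw [hv, tCoef_zero_mid_one hy hy1]
  have tu : tCoef 0 x 1 = u := by rw [hu, tCoef_zero_mid_one hx hx1]
  have t2 : tCoef x 0 0 = w := by rw [hw, tCoef_zero_zero hx]
  have t3 := tCoef_zero_mid_zero hx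
  have t5 := tCoef_zero_zero_zero (F := F)
  have tp : tCoef 0 x y = p := by
    rw [hp, tCoef, if_neg hx.symm, if_neg hxy2, zero_sub, cls_div hyx0 (neg_ne_zero.2 hx),
      cls_neg, hyx]
  have tq : tCoef x y 1 = q := by
    rw [hq, tCoef, if_neg hxy2, if_neg hy2, cls_div hy1 hxy]
  have t6 : tCoef x 0 y = r := by
    rw [hr, tCoef, if_neg hx, if_neg hy.symm, sub_zero, sub_zero, cls_div hy hx]
  have t7 : tCoef 0 0 y = r - w := by
    rw [hr, hw, tCoef, if_pos rfl, if_neg hy.symm, sub_zero]; abel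
  have a2 : ∀ h, SIaux 2 0 [x, y] 1 h =
      snoc (snoc (tprod ℚ (fun i : Fin 0 => i.elim0)) v) p +
      snoc (snoc (tprod ℚ (fun i : Fin 0 => i.elim0)) u) q := by
    intro h; rw [SIaux]; simp [Fin.sum_univ_succ, SIaux_single, tu, tv, tp, tq]
  have a3 : ∀ h, SIaux 3 0 [x, 0, y] 1 h = snoc (SIaux 2 0 [x, y] 1 rfl) r +
      snoc (SIaux 2 0 [x, 0] 1 rfl) v := by
    intro h; rw [SIaux]; simp [Fin.sum_univ_succ, tv, t3, t6]
  have a4 : ∀ h, SIaux 4 0 [x, 0, 0, y] 1 h = snoc (SIaux 3 0 [x, 0, y] 1 rfl) r +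
      snoc (SIaux 3 0 [x, 0, 0] 1 rfl) v := by
    intro h; rw [SIaux]; simp [Fin.sum_univ_succ, tv, t2, t3, t7]; abel
  have a5 : ∀ h, SIaux 5 0 [x, 0, 0, 0, y] 1 h = snoc (SIaux 4 0 [x, 0, 0, y] 1 rfl) r +
      snoc (SIaux 4 0 [x, 0, 0, 0] 1 rfl) v := by
    intro h; rw [SIaux]; simp [Fin.sum_univ_succ, tv, t2, t3, t5, t7]; abel
  rw [SI41, a5, a4, a3, a2, SIaux_four hx, SIaux_three hx, SIaux_two hx hx1, ← hu, ← hw]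
  simp only [map_add, LinearMap.add_apply]

end Symbols

section SymbolWords

variable {F : Type} [Field F]

/-- The word of the symbol of `Li₅(z)`, from the coordinates of `[z]` and `[1 - z]`. -/
def SLi5Words (wz wo : List ℤ) : List (ℤ × List (List ℤ)) :=
  [(-1, [wz, wz, wz, wz, wo])]

/-- The words of the symbol of `I_{4,1}(x, y)`, from the coordinates of `[x]`, `[y]`, `[1 - x]`,
`[1 - y]` and `[x - y]`. -/
def SI41Words (wx wy wox woy wxy : List ℤ) : List (ℤ × List (List ℤ)) :=
  let sub := List.zipWith fun a b : ℤ => a - b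
  let u := sub wox wx
  let v := sub woy wy
  let w := wx.map fun a => -a
  let r := sub wy wx
  [(1, [r, r, r, sub wxy wx, v]), (1, [r, r, r, sub woy wxy, u]), (1, [r, r, v, w, u]),
    (1, [r, v, w, w, u]), (1, [v, w, w, w, u])]

theorem vecOf_map_neg (m : ℕ) (e : ℕ → VF F) (a : List ℤ) :
    vecOf m e (a.map fun i => -i) = -vecOf m e a := by
  rw [vecOf, vecOf, ← Finset.sum_neg_distrib]
  refine Finset.sum_congr rfl fun l _ => ?_
  rw [← neg_smul]
  congr 1
  by_cases h : l < a.length <;> simp [List.getD_eq_getElem?_getD, h]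

theorem vecOf_zipWith_sub (m : ℕ) (e : ℕ → VF F) (a b : List ℤ) (h : a.length = b.length) :
    vecOf m e (List.zipWith (fun i j : ℤ => i - j) a b) = vecOf m e a - vecOf m e b := by
  rw [vecOf, vecOf, vecOf, ← Finset.sum_sub_distrib]
  refine Finset.sum_congr rfl fun l _ => ?_
  rw [← sub_smul]
  congr 1
  by_cases hl : l < b.length <;> simp [List.getD_eq_getElem?_getD, h, hl]

/-- Up to sign, `z` is the monomial in `g 0, …, g (m - 1)` with exponents `w`. -/
def IsMonomial (m : ℕ) (g : ℕ → F) (z : F) (w : List ℤ) : Prop :=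
  z ^ 2 = (∏ l ∈ Finset.range m, g l ^ w.getD l 0) ^ 2

theorem IsMonomial.ne_zero {m : ℕ} {g : ℕ → F} (hg : ∀ l, g l ≠ 0) {z : F} {w : List ℤ}
    (h : IsMonomial m g z w) : z ≠ 0 := by
  have h2 : z ^ 2 ≠ 0 := by
    rw [h]
    exact pow_ne_zero 2 (Finset.prod_ne_zero_iff.2 fun l _ => zpow_ne_zero _ (hg l))
  exact fun h0 => h2 (by rw [h0]; ring)

theorem IsMonomial.cls_eq {m : ℕ} {g : ℕ → F} (hg : ∀ l, g l ≠ 0) {z : F} {w : List ℤ}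
    (h : IsMonomial m g z w) : cls z = vecOf m (fun l => cls (g l)) w := by
  rw [← cls_prod_zpow m g (fun l _ => hg l)]
  exact cls_eq_of_sq_eq (h.ne_zero hg)
    (Finset.prod_ne_zero_iff.2 fun l _ => zpow_ne_zero _ (hg l)) h

theorem SLi5_eq_wordSum {m : ℕ} {g : ℕ → F} (hg : ∀ l, g l ≠ 0) {z : F} {wz wo : List ℤ}
    (hz : IsMonomial m g z wz) (ho : IsMonomial m g (1 - z) wo) :
    SLi5 z = wordSum m (fun l => cls (g l)) 5 (SLi5Words wz wo) := by
  rw [SLi5_eq (hz.ne_zero hg) (ho.ne_zero hg), hz.cls_eq hg, ho.cls_eq hg]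
  simp [wordSum, SLi5Words, wordTensor]

theorem SI41_eq_wordSum {m : ℕ} {g : ℕ → F} (hg : ∀ l, g l ≠ 0) {x y : F}
    {wx wy wox woy wxy : List ℤ} (hx : IsMonomial m g x wx) (hy : IsMonomial m g y wy)
    (hox : IsMonomial m g (1 - x) wox) (hoy : IsMonomial m g (1 - y) woy)
    (hxy : IsMonomial m g (x - y) wxy) (lx : wx.length = m) (ly : wy.length = m)
    (lox : wox.length = m) (loy : woy.length = m) (lxy : wxy.length = m) :
    SI41 x y = wordSum m (fun l => cls (g l)) 5 (SI41Words wx wy wox woy wxy) := by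
  rw [SI41_eq (hx.ne_zero hg) (hy.ne_zero hg) (hox.ne_zero hg) (hoy.ne_zero hg) (hxy.ne_zero hg)
    _ _ _ _ _ _ rfl rfl rfl rfl rfl rfl, hx.cls_eq hg, hy.cls_eq hg, hox.cls_eq hg,
    hoy.cls_eq hg, hxy.cls_eq hg]
  rw [← vecOf_zipWith_sub _ _ _ _ (lox.trans lx.symm),
    ← vecOf_zipWith_sub _ _ _ _ (loy.trans ly.symm),
    ← vecOf_zipWith_sub _ _ _ _ (lxy.trans lx.symm),
    ← vecOf_zipWith_sub _ _ _ _ (loy.trans lxy.symm),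
    ← vecOf_zipWith_sub _ _ _ _ (ly.trans lx.symm), ← vecOf_map_neg]
  simp only [wordSum, SI41Words, wordTensor, List.map_cons, List.map_nil, List.sum_cons,
    List.sum_nil, List.headD_cons, List.tail_cons, Int.cast_one, one_smul, add_zero, add_assoc]

end SymbolWords

section OneMinus

variable {F : Type} [Field F]

/-- The linear combination with integral coefficients of lists of words. -/
def combineWords (ts : List (ℤ × List (ℤ × List (List ℤ)))) : List (ℤ × List (List ℤ)) :=
  ts.flatMap fun t => t.2.map fun u => (t.1 * u.1, u.2)

theorem wordSum_combineWords (m : ℕ) (e : ℕ → VF F) (n : ℕ)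
    (ts : List (ℤ × List (ℤ × List (List ℤ)))) :
    wordSum m e n (combineWords ts) =
      (ts.map fun t => (t.1 : ℚ) • wordSum m e n t.2).sum := by
  induction ts with
  | nil => simp [combineWords, wordSum_nil]
  | cons t ts ih =>
    rw [List.map_cons, List.sum_cons, ← ih, combineWords, List.flatMap_cons, wordSum_append,
      wordSum_map_mul, combineWords]

/-- The irreducible factors occurring in the symbols of `I⁺_{4,1}(x, y)` and
`I⁺_{4,1}(1 - x, y)`. -/
def oneMinusLetter (x y : F) (l : ℕ) : F :=
  [x, 1 - x, y, 1 - y, 1 - x * y, x - y, 1 - x - y, 1 - y + x * y].getD l 1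

/-- Twelve times the difference of the two sides of the functional equation relating
`I⁺_{4,1}(x, y)` and `I⁺_{4,1}(1 - x, y)`, as a linear combination of symbols. -/
def oneMinusWords : List (ℤ × List (ℤ × List (List ℤ))) :=
  [(6, SI41Words [1, 0, 0, 0, 0, 0, 0, 0] [0, 0, 1, 0, 0, 0, 0, 0] [0, 1, 0, 0, 0, 0, 0, 0]
      [0, 0, 0, 1, 0, 0, 0, 0] [0, 0, 0, 0, 0, 1, 0, 0]),
    (6, SI41Words [1, 0, 0, 0, 0, 0, 0, 0] [0, 0, -1, 0, 0, 0, 0, 0] [0, 1, 0, 0, 0, 0, 0, 0]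
      [0, 0, -1, 1, 0, 0, 0, 0] [0, 0, -1, 0, 1, 0, 0, 0]),
    (6, SI41Words [0, 1, 0, 0, 0, 0, 0, 0] [0, 0, 1, 0, 0, 0, 0, 0] [1, 0, 0, 0, 0, 0, 0, 0]
      [0, 0, 0, 1, 0, 0, 0, 0] [0, 0, 0, 0, 0, 0, 1, 0]),
    (6, SI41Words [0, 1, 0, 0, 0, 0, 0, 0] [0, 0, -1, 0, 0, 0, 0, 0] [1, 0, 0, 0, 0, 0, 0, 0]
      [0, 0, -1, 1, 0, 0, 0, 0] [0, 0, -1, 0, 0, 0, 0, 1]),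
    (-1, SLi5Words [2, -1, 1, -2, 0, 0, 0, 0] [0, -1, 0, -2, 0, 0, 1, 1]),
    (-1, SLi5Words [-1, 2, 1, -2, 0, 0, 0, 0] [-1, 0, 0, -2, 1, 1, 0, 0]),
    (-2, SLi5Words [1, 1, 2, -1, 0, 0, 0, 0] [0, 0, 0, -1, 1, 0, 0, 1]),
    (-2, SLi5Words [-1, -1, 1, 1, 0, 0, 0, 0] [-1, -1, 0, 0, 0, 1, 1, 0]),
    (6, SLi5Words [-1, 1, 0, -1, 0, 0, 0, 0] [-1, 0, 0, -1, 1, 0, 0, 0]),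
    (6, SLi5Words [1, -1, 1, -1, 0, 0, 0, 0] [0, -1, 0, -1, 0, 0, 1, 0]),
    (6, SLi5Words [-1, 1, 0, 1, 0, 0, 0, 0] [-1, 0, 0, 0, 0, 0, 0, 1]),
    (6, SLi5Words [-1, 1, 1, -1, 0, 0, 0, 0] [-1, 0, 0, -1, 0, 1, 0, 0]),
    (21, SLi5Words [0, -1, 1, 0, 0, 0, 0, 0] [0, -1, 0, 0, 0, 0, 1, 0]),
    (21, SLi5Words [0, 1, 1, 0, 0, 0, 0, 0] [0, 0, 0, 0, 0, 0, 0, 1]),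
    (21, SLi5Words [-1, 0, 1, 0, 0, 0, 0, 0] [-1, 0, 0, 0, 0, 1, 0, 0]),
    (21, SLi5Words [1, 0, 1, 0, 0, 0, 0, 0] [0, 0, 0, 0, 1, 0, 0, 0]),
    (12, SLi5Words [-1, 0, 0, 1, 0, 0, 0, 0] [-1, 0, 0, 0, 0, 0, 1, 0]),
    (12, SLi5Words [0, 1, 0, -1, 0, 0, 0, 0] [0, 0, 0, -1, 0, 1, 0, 0]),
    (12, SLi5Words [0, 1, 1, -1, 0, 0, 0, 0] [0, 0, 0, -1, 1, 0, 0, 0]),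
    (12, SLi5Words [1, 0, 1, -1, 0, 0, 0, 0] [0, 0, 0, -1, 0, 0, 0, 1]),
    (-6, SLi5Words [0, 1, 0, 0, 0, 0, 0, 0] [1, 0, 0, 0, 0, 0, 0, 0]),
    (-6, SLi5Words [-1, 0, 0, 0, 0, 0, 0, 0] [-1, 1, 0, 0, 0, 0, 0, 0]),
    (-12, SLi5Words [-1, 1, 0, 0, 0, 0, 0, 0] [-1, 0, 0, 0, 0, 0, 0, 0]),
    (-12, SLi5Words [0, 0, 0, -1, 0, 0, 0, 0] [0, 0, 1, -1, 0, 0, 0, 0]),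
    (-12, SLi5Words [0, 0, 1, -1, 0, 0, 0, 0] [0, 0, 0, -1, 0, 0, 0, 0])]

theorem Pit_oneMinusWords (e : ℕ → VF F) :
    Pit 5 (wordSum 8 e 5 (combineWords oneMinusWords)) = 0 := by
  rw [Pit_wordSum]
  exact wordSum_eq_zero 8 e 5 _ (by decide +kernel)

theorem Pit_I41p_add_I41p_one_sub {x y : F} (hg : ∀ l, oneMinusLetter x y l ≠ 0) :
    Pit 5 (I41p x y + I41p (1 - x) y) =
      Pit 5 (
        ((1 : ℚ) / 12) • SLi5 (x ^ 2 * y / ((1 - x) * (1 - y) ^ 2))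
        + ((1 : ℚ) / 12) • SLi5 ((1 - x) ^ 2 * y / (x * (1 - y) ^ 2))
        + ((1 : ℚ) / 6) • SLi5 ((1 - x) * x * y ^ 2 / (y - 1))
        + ((1 : ℚ) / 6) • SLi5 ((1 - y) * y / ((1 - x) * x))
        - ((1 : ℚ) / 2) • SLi5 ((1 - x) / (x * (y - 1)))
        - ((1 : ℚ) / 2) • SLi5 (x * y / ((1 - x) * (1 - y)))
        - ((1 : ℚ) / 2) • SLi5 ((1 - x) * (1 - y) / (-x))
        - ((1 : ℚ) / 2) • SLi5 ((1 - x) * y / (x * (1 - y)))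
        - ((7 : ℚ) / 4) • SLi5 (y / (1 - x))
        - ((7 : ℚ) / 4) • SLi5 ((1 - x) * y)
        - ((7 : ℚ) / 4) • SLi5 (y / x)
        - ((7 : ℚ) / 4) • SLi5 (x * y)
        - SLi5 ((1 - y) / x)
        - SLi5 ((1 - x) / (1 - y))
        - SLi5 ((1 - x) * y / (y - 1))
        - SLi5 (x * y / (y - 1))
        + ((1 : ℚ) / 2) • SLi5 (1 - x)
        + ((1 : ℚ) / 2) • SLi5 x⁻¹
        + SLi5 ((x - 1) / x)
        + SLi5 ((1 - y)⁻¹)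
        + SLi5 (y / (y - 1))) := by
  have hx : x ≠ 0 := hg 0
  have hx1 : 1 - x ≠ 0 := hg 1
  have hy : y ≠ 0 := hg 2
  have hy1 : 1 - y ≠ 0 := hg 3
  have hy2 : y - 1 ≠ 0 := by rw [← neg_sub]; exact neg_ne_zero.2 hy1
  have e1 : SI41 x y = wordSum 8 (fun l => cls (oneMinusLetter x y l)) 5
      (SI41Words [1, 0, 0, 0, 0, 0, 0, 0] [0, 0, 1, 0, 0, 0, 0, 0] [0, 1, 0, 0, 0, 0, 0, 0]
        [0, 0, 0, 1, 0, 0, 0, 0] [0, 0, 0, 0, 0, 1, 0, 0]) := by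
    refine SI41_eq_wordSum hg ?_ ?_ ?_ ?_ ?_ rfl rfl rfl rfl rfl <;>
      simp [IsMonomial, oneMinusLetter, Finset.prod_range_succ]
  have e2 : SI41 x y⁻¹ = wordSum 8 (fun l => cls (oneMinusLetter x y l)) 5
      (SI41Words [1, 0, 0, 0, 0, 0, 0, 0] [0, 0, -1, 0, 0, 0, 0, 0] [0, 1, 0, 0, 0, 0, 0, 0]
        [0, 0, -1, 1, 0, 0, 0, 0] [0, 0, -1, 0, 1, 0, 0, 0]) := by
    refine SI41_eq_wordSum hg ?_ ?_ ?_ ?_ ?_ rfl rfl rfl rfl rfl <;>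
      simp [IsMonomial, oneMinusLetter, Finset.prod_range_succ] <;> (try field_simp) <;> (try ring)
  have e3 : SI41 (1 - x) y = wordSum 8 (fun l => cls (oneMinusLetter x y l)) 5
      (SI41Words [0, 1, 0, 0, 0, 0, 0, 0] [0, 0, 1, 0, 0, 0, 0, 0] [1, 0, 0, 0, 0, 0, 0, 0]
        [0, 0, 0, 1, 0, 0, 0, 0] [0, 0, 0, 0, 0, 0, 1, 0]) := by
    refine SI41_eq_wordSum hg ?_ ?_ ?_ ?_ ?_ rfl rfl rfl rfl rfl <;>
      simp [IsMonomial, oneMinusLetter, Finset.prod_range_succ]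
  have e4 : SI41 (1 - x) y⁻¹ = wordSum 8 (fun l => cls (oneMinusLetter x y l)) 5
      (SI41Words [0, 1, 0, 0, 0, 0, 0, 0] [0, 0, -1, 0, 0, 0, 0, 0] [1, 0, 0, 0, 0, 0, 0, 0]
        [0, 0, -1, 1, 0, 0, 0, 0] [0, 0, -1, 0, 0, 0, 0, 1]) := by
    refine SI41_eq_wordSum hg ?_ ?_ ?_ ?_ ?_ rfl rfl rfl rfl rfl <;>
      simp [IsMonomial, oneMinusLetter, Finset.prod_range_succ] <;> (try field_simp) <;> (try ring)
  have e5 : SLi5 (x ^ 2 * y / ((1 - x) * (1 - y) ^ 2)) =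
      wordSum 8 (fun l => cls (oneMinusLetter x y l)) 5
        (SLi5Words [2, -1, 1, -2, 0, 0, 0, 0] [0, -1, 0, -2, 0, 0, 1, 1]) := by
    refine SLi5_eq_wordSum hg ?_ ?_ <;>
      simp [IsMonomial, oneMinusLetter, Finset.prod_range_succ] <;> (try field_simp) <;> (try ring)
  have e6 : SLi5 ((1 - x) ^ 2 * y / (x * (1 - y) ^ 2)) =
      wordSum 8 (fun l => cls (oneMinusLetter x y l)) 5
        (SLi5Words [-1, 2, 1, -2, 0, 0, 0, 0] [-1, 0, 0, -2, 1, 1, 0, 0]) := by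
    refine SLi5_eq_wordSum hg ?_ ?_ <;>
      simp [IsMonomial, oneMinusLetter, Finset.prod_range_succ] <;> (try field_simp) <;> (try ring)
  have e7 : SLi5 ((1 - x) * x * y ^ 2 / (y - 1)) =
      wordSum 8 (fun l => cls (oneMinusLetter x y l)) 5
        (SLi5Words [1, 1, 2, -1, 0, 0, 0, 0] [0, 0, 0, -1, 1, 0, 0, 1]) := by
    refine SLi5_eq_wordSum hg ?_ ?_ <;>
      simp [IsMonomial, oneMinusLetter, Finset.prod_range_succ] <;> (try field_simp) <;> (try ring)
  have e8 : SLi5 ((1 - y) * y / ((1 - x) * x)) =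
      wordSum 8 (fun l => cls (oneMinusLetter x y l)) 5
        (SLi5Words [-1, -1, 1, 1, 0, 0, 0, 0] [-1, -1, 0, 0, 0, 1, 1, 0]) := by
    refine SLi5_eq_wordSum hg ?_ ?_ <;>
      simp [IsMonomial, oneMinusLetter, Finset.prod_range_succ] <;> (try field_simp) <;> (try ring)
  have e9 : SLi5 ((1 - x) / (x * (y - 1))) =
      wordSum 8 (fun l => cls (oneMinusLetter x y l)) 5
        (SLi5Words [-1, 1, 0, -1, 0, 0, 0, 0] [-1, 0, 0, -1, 1, 0, 0, 0]) := by
    refine SLi5_eq_wordSum hg ?_ ?_ <;>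
      simp [IsMonomial, oneMinusLetter, Finset.prod_range_succ] <;> (try field_simp) <;> (try ring)
  have e10 : SLi5 (x * y / ((1 - x) * (1 - y))) =
      wordSum 8 (fun l => cls (oneMinusLetter x y l)) 5
        (SLi5Words [1, -1, 1, -1, 0, 0, 0, 0] [0, -1, 0, -1, 0, 0, 1, 0]) := by
    refine SLi5_eq_wordSum hg ?_ ?_ <;>
      simp [IsMonomial, oneMinusLetter, Finset.prod_range_succ] <;> (try field_simp) <;> (try ring)
  have e11 : SLi5 ((1 - x) * (1 - y) / (-x)) =
      wordSum 8 (fun l => cls (oneMinusLetter x y l)) 5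
        (SLi5Words [-1, 1, 0, 1, 0, 0, 0, 0] [-1, 0, 0, 0, 0, 0, 0, 1]) := by
    refine SLi5_eq_wordSum hg ?_ ?_ <;>
      simp [IsMonomial, oneMinusLetter, Finset.prod_range_succ] <;> (try field_simp) <;> (try ring)
  have e12 : SLi5 ((1 - x) * y / (x * (1 - y))) =
      wordSum 8 (fun l => cls (oneMinusLetter x y l)) 5
        (SLi5Words [-1, 1, 1, -1, 0, 0, 0, 0] [-1, 0, 0, -1, 0, 1, 0, 0]) := by
    refine SLi5_eq_wordSum hg ?_ ?_ <;>
      simp [IsMonomial, oneMinusLetter, Finset.prod_range_succ] <;> (try field_simp) <;> (try ring)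
  have e13 : SLi5 (y / (1 - x)) =
      wordSum 8 (fun l => cls (oneMinusLetter x y l)) 5
        (SLi5Words [0, -1, 1, 0, 0, 0, 0, 0] [0, -1, 0, 0, 0, 0, 1, 0]) := by
    refine SLi5_eq_wordSum hg ?_ ?_ <;>
      simp [IsMonomial, oneMinusLetter, Finset.prod_range_succ] <;> (try field_simp)
  have e14 : SLi5 ((1 - x) * y) =
      wordSum 8 (fun l => cls (oneMinusLetter x y l)) 5
        (SLi5Words [0, 1, 1, 0, 0, 0, 0, 0] [0, 0, 0, 0, 0, 0, 0, 1]) := by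
    refine SLi5_eq_wordSum hg ?_ ?_ <;>
      simp [IsMonomial, oneMinusLetter, Finset.prod_range_succ] <;> (try field_simp) <;> (try ring)
  have e15 : SLi5 (y / x) =
      wordSum 8 (fun l => cls (oneMinusLetter x y l)) 5
        (SLi5Words [-1, 0, 1, 0, 0, 0, 0, 0] [-1, 0, 0, 0, 0, 1, 0, 0]) := by
    refine SLi5_eq_wordSum hg ?_ ?_ <;>
      simp [IsMonomial, oneMinusLetter, Finset.prod_range_succ] <;> (try field_simp)
  have e16 : SLi5 (x * y) =
      wordSum 8 (fun l => cls (oneMinusLetter x y l)) 5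
        (SLi5Words [1, 0, 1, 0, 0, 0, 0, 0] [0, 0, 0, 0, 1, 0, 0, 0]) := by
    refine SLi5_eq_wordSum hg ?_ ?_ <;>
      simp [IsMonomial, oneMinusLetter, Finset.prod_range_succ]
  have e17 : SLi5 ((1 - y) / x) =
      wordSum 8 (fun l => cls (oneMinusLetter x y l)) 5
        (SLi5Words [-1, 0, 0, 1, 0, 0, 0, 0] [-1, 0, 0, 0, 0, 0, 1, 0]) := by
    refine SLi5_eq_wordSum hg ?_ ?_ <;>
      simp [IsMonomial, oneMinusLetter, Finset.prod_range_succ] <;> (try field_simp) <;> (try ring)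
  have e18 : SLi5 ((1 - x) / (1 - y)) =
      wordSum 8 (fun l => cls (oneMinusLetter x y l)) 5
        (SLi5Words [0, 1, 0, -1, 0, 0, 0, 0] [0, 0, 0, -1, 0, 1, 0, 0]) := by
    refine SLi5_eq_wordSum hg ?_ ?_ <;>
      simp [IsMonomial, oneMinusLetter, Finset.prod_range_succ] <;> (try field_simp) <;> (try ring)
  have e19 : SLi5 ((1 - x) * y / (y - 1)) =
      wordSum 8 (fun l => cls (oneMinusLetter x y l)) 5
        (SLi5Words [0, 1, 1, -1, 0, 0, 0, 0] [0, 0, 0, -1, 1, 0, 0, 0]) := by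
    refine SLi5_eq_wordSum hg ?_ ?_ <;>
      simp [IsMonomial, oneMinusLetter, Finset.prod_range_succ] <;> (try field_simp) <;> (try ring)
  have e20 : SLi5 (x * y / (y - 1)) =
      wordSum 8 (fun l => cls (oneMinusLetter x y l)) 5
        (SLi5Words [1, 0, 1, -1, 0, 0, 0, 0] [0, 0, 0, -1, 0, 0, 0, 1]) := by
    refine SLi5_eq_wordSum hg ?_ ?_ <;>
      simp [IsMonomial, oneMinusLetter, Finset.prod_range_succ] <;> (try field_simp) <;> (try ring)
  have e21 : SLi5 (1 - x) =
      wordSum 8 (fun l => cls (oneMinusLetter x y l)) 5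
        (SLi5Words [0, 1, 0, 0, 0, 0, 0, 0] [1, 0, 0, 0, 0, 0, 0, 0]) := by
    refine SLi5_eq_wordSum hg ?_ ?_ <;>
      simp [IsMonomial, oneMinusLetter, Finset.prod_range_succ]
  have e22 : SLi5 x⁻¹ =
      wordSum 8 (fun l => cls (oneMinusLetter x y l)) 5
        (SLi5Words [-1, 0, 0, 0, 0, 0, 0, 0] [-1, 1, 0, 0, 0, 0, 0, 0]) := by
    refine SLi5_eq_wordSum hg ?_ ?_ <;>
      simp [IsMonomial, oneMinusLetter, Finset.prod_range_succ] <;> (try field_simp) <;> (try ring)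
  have e23 : SLi5 ((x - 1) / x) =
      wordSum 8 (fun l => cls (oneMinusLetter x y l)) 5
        (SLi5Words [-1, 1, 0, 0, 0, 0, 0, 0] [-1, 0, 0, 0, 0, 0, 0, 0]) := by
    refine SLi5_eq_wordSum hg ?_ ?_ <;>
      simp [IsMonomial, oneMinusLetter, Finset.prod_range_succ] <;> (try field_simp) <;> (try ring)
  have e24 : SLi5 ((1 - y)⁻¹) =
      wordSum 8 (fun l => cls (oneMinusLetter x y l)) 5
        (SLi5Words [0, 0, 0, -1, 0, 0, 0, 0] [0, 0, 1, -1, 0, 0, 0, 0]) := by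
    refine SLi5_eq_wordSum hg ?_ ?_ <;>
      simp [IsMonomial, oneMinusLetter, Finset.prod_range_succ] <;> (try field_simp) <;> (try ring)
  have e25 : SLi5 (y / (y - 1)) =
      wordSum 8 (fun l => cls (oneMinusLetter x y l)) 5
        (SLi5Words [0, 0, 1, -1, 0, 0, 0, 0] [0, 0, 0, -1, 0, 0, 0, 0]) := by
    refine SLi5_eq_wordSum hg ?_ ?_ <;>
      simp [IsMonomial, oneMinusLetter, Finset.prod_range_succ] <;> (try field_simp) <;> (try ring)
  rw [← sub_eq_zero, ← map_sub, I41p, I41p, e1, e2, e3, e4, e5, e6, e7, e8, e9, e10, e11, e12,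
    e13, e14, e15, e16, e17, e18, e19, e20, e21, e22, e23, e24, e25]
  refine (smul_right_injective (TP F 5) (by norm_num : (12 : ℚ) ≠ 0)) ?_
  beta_reduce
  rw [smul_zero, ← map_smul, ← Pit_oneMinusWords fun l => cls (oneMinusLetter x y l)]
  refine congrArg (Pit 5) ?_
  rw [wordSum_combineWords]
  simp only [oneMinusWords, List.map_cons, List.map_nil, List.sum_cons, List.sum_nil]
  push_cast
  module

end OneMinus

theorem algebraMap_ne_zero_of_eval {p : MvPolynomial (Fin 2) ℚ} (v : Fin 2 → ℚ)
    (h : MvPolynomial.eval v p ≠ 0) : algebraMap (MvPolynomial (Fin 2) ℚ) K2 p ≠ 0 := by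
  intro h0
  rw [map_eq_zero_iff _ (IsFractionRing.injective (MvPolynomial (Fin 2) ℚ) K2)] at h0
  exact h (by rw [h0, map_zero])

theorem oneMinusLetter_xx_yy_ne_zero (l : ℕ) : oneMinusLetter xx yy l ≠ 0 := by
  have key : ∃ p : MvPolynomial (Fin 2) ℚ, MvPolynomial.eval ![2, 3] p ≠ 0 ∧
      algebraMap (MvPolynomial (Fin 2) ℚ) K2 p = oneMinusLetter xx yy l := by
    let X : MvPolynomial (Fin 2) ℚ := MvPolynomial.X 0
    let Y : MvPolynomial (Fin 2) ℚ := MvPolynomial.X 1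
    refine ⟨[X, 1 - X, Y, 1 - Y, 1 - X * Y, X - Y, 1 - X - Y, 1 - Y + X * Y].getD l 1, ?_, ?_⟩ <;>
    rcases l with _ | _ | _ | _ | _ | _ | _ | _ | l <;>
    simp [oneMinusLetter, X, Y, xx, yy] <;> norm_num
  obtain ⟨p, hp, h⟩ := key
  rw [← h]
  exact algebraMap_ne_zero_of_eval _ hp

end GrassPoly

/-- the `x ↦ 1-x` identity for `I⁺_{4,1}`. -/
theorem i41p_one_minus_x :
    Pit 5 (I41p xx yy + I41p (1 - xx) yy) =
      Pit 5 (
        ((1 : ℚ) / 12) • SLi5 (xx ^ 2 * yy / ((1 - xx) * (1 - yy) ^ 2))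
        + ((1 : ℚ) / 12) • SLi5 ((1 - xx) ^ 2 * yy / (xx * (1 - yy) ^ 2))
        + ((1 : ℚ) / 6) • SLi5 ((1 - xx) * xx * yy ^ 2 / (yy - 1))
        + ((1 : ℚ) / 6) • SLi5 ((1 - yy) * yy / ((1 - xx) * xx))
        - ((1 : ℚ) / 2) • SLi5 ((1 - xx) / (xx * (yy - 1)))
        - ((1 : ℚ) / 2) • SLi5 (xx * yy / ((1 - xx) * (1 - yy)))
        - ((1 : ℚ) / 2) • SLi5 ((1 - xx) * (1 - yy) / (-xx))
        - ((1 : ℚ) / 2) • SLi5 ((1 - xx) * yy / (xx * (1 - yy)))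
        - ((7 : ℚ) / 4) • SLi5 (yy / (1 - xx))
        - ((7 : ℚ) / 4) • SLi5 ((1 - xx) * yy)
        - ((7 : ℚ) / 4) • SLi5 (yy / xx)
        - ((7 : ℚ) / 4) • SLi5 (xx * yy)
        - SLi5 ((1 - yy) / xx)
        - SLi5 ((1 - xx) / (1 - yy))
        - SLi5 ((1 - xx) * yy / (yy - 1))
        - SLi5 (xx * yy / (yy - 1))
        + ((1 : ℚ) / 2) • SLi5 (1 - xx)
        + ((1 : ℚ) / 2) • SLi5 xx⁻¹
        + SLi5 ((xx - 1) / xx)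
        + SLi5 ((1 - yy)⁻¹)
        + SLi5 (yy / (yy - 1))) := by
  exact Pit_I41p_add_I41p_one_sub oneMinusLetter_xx_yy_ne_zero
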